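/- Let Λ be a weight such that (Λ,α) < 0 for all α ∈ A, (Λ,β) = 0 for all β ∈ B, and Λ + γ is regular. Then (Λ + γ, δ) < 0 for every significant (A,B)-root δ. -/

import Mathlib

open scoped RealInnerProductSpace
open scoped Classical

/-- A reduced crystallographic root system `roots` spanning a real inner product
space `V`, with a chosen set `pos` of positive roots, the corresponding base
`simple` of simple roots, and the coefficient function `coeff`, where
`coeff ξ α = c_α(ξ)` is the coefficient of the simple root `α` in the unique
expression `ξ = ∑_{α ∈ simple} c_α(ξ) • α`. -/
structure RootSystemData (V : Type*) [NormedAddCommGroup V] [InnerProductSpace ℝ V] where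
  roots : Finset V
  pos : Finset V
  simple : Finset V
  coeff : V → V → ℝ
  pos_subset : pos ⊆ roots
  simple_subset : simple ⊆ pos
  root_ne_zero : ∀ δ ∈ roots, δ ≠ (0 : V)
  neg_mem : ∀ δ ∈ roots, -δ ∈ roots
  pos_or_neg : ∀ δ ∈ roots, δ ∈ pos ∨ -δ ∈ pos
  pos_neg_not : ∀ δ ∈ pos, -δ ∉ pos
  reduced : ∀ δ ∈ roots, ∀ t : ℝ, t • δ ∈ roots → t = 1 ∨ t = -1
  crystallographic : ∀ δ ∈ roots, ∀ ε ∈ roots, ∃ n : ℤ, 2 * ⟪δ, ε⟫ / ⟪ε, ε⟫ = (n : ℝ)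
  reflect_mem : ∀ δ ∈ roots, ∀ ε ∈ roots, δ - (2 * ⟪δ, ε⟫ / ⟪ε, ε⟫) • ε ∈ roots
  span_eq_top : Submodule.span ℝ (simple : Set V) = ⊤
  linearIndependent : LinearIndependent ℝ (fun α : simple => (α : V))
  coeff_spec : ∀ ξ : V, ξ = ∑ α ∈ simple, coeff ξ α • α
  pos_coeff_nonneg : ∀ δ ∈ pos, ∀ α ∈ simple, 0 ≤ coeff δ α

namespace RootSystemData

variable {V : Type*} [NormedAddCommGroup V] [InnerProductSpace ℝ V]

/-- The support `C(ξ)` of `ξ`: the set of simple roots with nonzero coefficient in `ξ`. -/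
noncomputable def support (R : RootSystemData V) (ξ : V) : Finset V :=
  R.simple.filter fun α => R.coeff ξ α ≠ 0

/-- The coefficientwise partial order: `x ≤ y` iff `c_α(x) ≤ c_α(y)` for all simple `α`. -/
def cle (R : RootSystemData V) (x y : V) : Prop :=
  ∀ α ∈ R.simple, R.coeff x α ≤ R.coeff y α

/-- An `(A,B)`-root: a positive root whose support lies in `A ∪ B` and which has a
strictly positive coefficient at some element of `A`. -/
def IsABRoot (R : RootSystemData V) (A B : Finset V) (δ : V) : Prop :=
  δ ∈ R.pos ∧ R.support δ ⊆ A ∪ B ∧ ∃ α₀ ∈ A, 0 < R.coeff δ α₀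

/-- A significant `(A,B)`-root. -/
def IsSignificant (R : RootSystemData V) (A B : Finset V) (δ : V) : Prop :=
  R.IsABRoot A B δ ∧ ∃ σ : V, R.IsABRoot A B σ ∧ R.cle σ δ ∧
    (∑ β ∈ B, R.coeff σ β * ⟪β, β⟫) ≤ (∑ α ∈ A, R.coeff σ α * ⟪α, α⟫) ∧
    (∀ x ∈ R.support (δ - σ), ∀ y ∈ R.support (δ - σ), ‖x‖ = ‖y‖) ∧
    (∀ x ∈ R.support (δ - σ), ‖x‖ ≤ ‖σ‖)

/-- `ℓ(A,B)`, the number of significant `(A,B)`-roots. -/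
noncomputable def ell (R : RootSystemData V) (A B : Finset V) : ℕ :=
  (R.pos.filter fun δ => R.IsSignificant A B δ).card

/-- `γ`, the half-sum of the positive roots. -/
noncomputable def gamma (R : RootSystemData V) : V :=
  (2 : ℝ)⁻¹ • ∑ δ ∈ R.pos, δ

/-- A weight: `2(β,α)/(α,α) ∈ ℤ` for all roots `α`. -/
def IsWeight (R : RootSystemData V) (β : V) : Prop :=
  ∀ δ ∈ R.roots, ∃ n : ℤ, 2 * ⟪β, δ⟫ / ⟪δ, δ⟫ = (n : ℝ)

/-- A regular weight: not orthogonal to any positive root. -/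
def IsRegular (R : RootSystemData V) (lam : V) : Prop :=
  ∀ δ ∈ R.pos, ⟪lam, δ⟫ ≠ 0

end RootSystemData


namespace RootSystemData

variable {V : Type*} [NormedAddCommGroup V] [InnerProductSpace ℝ V] (R : RootSystemData V)

section Coefficients

lemma coeff_eq_of_eq_sum {ξ : V} {f : V → ℝ} (h : ξ = ∑ α ∈ R.simple, f α • α)
    {α : V} (hα : α ∈ R.simple) : R.coeff ξ α = f α := by
  have key : ∑ β ∈ R.simple, (R.coeff ξ β - f β) • β = 0 := by
    simp only [sub_smul, Finset.sum_sub_distrib]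
    rw [← R.coeff_spec ξ, ← h, sub_self]
  rw [← Finset.sum_coe_sort] at key
  have := Fintype.linearIndependent_iff.mp R.linearIndependent
    (fun β => R.coeff ξ β - f β) key ⟨α, hα⟩
  exact sub_eq_zero.mp this

lemma coeff_neg (ξ : V) {α : V} (hα : α ∈ R.simple) : R.coeff (-ξ) α = -R.coeff ξ α := by
  refine R.coeff_eq_of_eq_sum (f := fun β => -R.coeff ξ β) ?_ hα
  simp only [neg_smul, Finset.sum_neg_distrib]
  rw [← R.coeff_spec ξ]

lemma coeff_sub (ξ η : V) {α : V} (hα : α ∈ R.simple) :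
    R.coeff (ξ - η) α = R.coeff ξ α - R.coeff η α := by
  refine R.coeff_eq_of_eq_sum (f := fun β => R.coeff ξ β - R.coeff η β) ?_ hα
  simp only [sub_smul, Finset.sum_sub_distrib]
  rw [← R.coeff_spec ξ, ← R.coeff_spec η]

lemma coeff_smul_simple (t : ℝ) {α β : V} (hα : α ∈ R.simple) (hβ : β ∈ R.simple) :
    R.coeff (t • α) β = if β = α then t else 0 :=
  R.coeff_eq_of_eq_sum (f := fun β => if β = α then t else 0) (by simp [ite_smul, hα]) hβ

lemma coeff_sub_smul_simple (ξ : V) (t : ℝ) {α β : V} (hα : α ∈ R.simple)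
    (hβ : β ∈ R.simple) :
    R.coeff (ξ - t • α) β = R.coeff ξ β - if β = α then t else 0 := by
  rw [R.coeff_sub _ _ hβ, R.coeff_smul_simple t hα hβ]

/-- The height of `ξ`: the sum of its coefficients. -/
noncomputable def height (ξ : V) : ℝ := ∑ α ∈ R.simple, R.coeff ξ α

lemma height_sub_smul_simple (ξ : V) (t : ℝ) {α : V} (hα : α ∈ R.simple) :
    R.height (ξ - t • α) = R.height ξ - t := by
  unfold height
  rw [Finset.sum_congr rfl fun β hβ => R.coeff_sub_smul_simple ξ t hα hβ,
    Finset.sum_sub_distrib]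
  simp [hα]

lemma inner_eq_sum_coeff (μ ξ : V) :
    ⟪μ, ξ⟫ = ∑ α ∈ R.simple, R.coeff ξ α * ⟪μ, α⟫ := by
  conv_lhs => rw [R.coeff_spec ξ]
  simp only [inner_sum, real_inner_smul_right]

lemma eq_zero_of_coeff_eq_zero {ξ : V} (h : ∀ α ∈ R.simple, R.coeff ξ α = 0) : ξ = 0 := by
  rw [R.coeff_spec ξ]
  exact Finset.sum_eq_zero fun α hα => by rw [h α hα, zero_smul]

/-- A vector with nonnegative coefficients has positive inner product with some simple root
occurring in it. -/
lemma exists_simple_inner_pos {ξ : V} (hξ : ξ ≠ 0)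
    (hc : ∀ α ∈ R.simple, 0 ≤ R.coeff ξ α) :
    ∃ α ∈ R.simple, 0 < R.coeff ξ α ∧ 0 < ⟪ξ, α⟫ := by
  by_contra! H
  have h : ⟪ξ, ξ⟫ ≤ 0 := by
    conv_lhs => rw [R.inner_eq_sum_coeff ξ ξ]
    refine Finset.sum_nonpos fun α hα => ?_
    rcases (hc α hα).eq_or_lt with h0 | h0
    · simp [← h0]
    · exact mul_nonpos_of_nonneg_of_nonpos h0.le (H α hα h0)
  exact absurd (real_inner_self_pos.mpr hξ) h.not_gt

end Coefficients

section Roots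

lemma simple_mem_roots {α : V} (hα : α ∈ R.simple) : α ∈ R.roots :=
  R.pos_subset (R.simple_subset hα)

lemma inner_self_pos {δ : V} (hδ : δ ∈ R.roots) : 0 < ⟪δ, δ⟫ :=
  real_inner_self_pos.mpr (R.root_ne_zero δ hδ)

lemma exists_int_inner {δ ε : V} (hδ : δ ∈ R.roots) (hε : ε ∈ R.roots) :
    ∃ n : ℤ, 2 * ⟪δ, ε⟫ = n * ⟪ε, ε⟫ := by
  obtain ⟨n, hn⟩ := R.crystallographic δ hδ ε hε
  exact ⟨n, (div_eq_iff (R.inner_self_pos hε).ne').mp hn⟩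

lemma sub_smul_mem {δ ε : V} (hδ : δ ∈ R.roots) (hε : ε ∈ R.roots) {k : ℝ}
    (hk : 2 * ⟪δ, ε⟫ = k * ⟪ε, ε⟫) : δ - k • ε ∈ R.roots := by
  have := R.reflect_mem δ hδ ε hε
  rwa [(div_eq_iff (R.inner_self_pos hε).ne').mpr hk] at this

lemma mem_pos_of_coeff_nonneg {δ : V} (hδ : δ ∈ R.roots)
    (hc : ∀ α ∈ R.simple, 0 ≤ R.coeff δ α) : δ ∈ R.pos := by
  refine (R.pos_or_neg δ hδ).resolve_right fun hn => R.root_ne_zero δ hδ ?_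
  refine R.eq_zero_of_coeff_eq_zero fun α hα => le_antisymm ?_ (hc α hα)
  have := R.pos_coeff_nonneg _ hn α hα
  rw [R.coeff_neg _ hα] at this
  linarith

lemma mem_pos_of_coeff_pos {δ : V} (hδ : δ ∈ R.roots) {α : V} (hα : α ∈ R.simple)
    (hc : 0 < R.coeff δ α) : δ ∈ R.pos := by
  refine (R.pos_or_neg δ hδ).resolve_right fun hn => ?_
  have := R.pos_coeff_nonneg _ hn α hα
  rw [R.coeff_neg _ hα] at this
  linarith

/-- If two distinct roots have positive inner product then their difference is a root. -/
lemma sub_mem_roots {δ ε : V} (hδ : δ ∈ R.roots) (hε : ε ∈ R.roots) (hne : δ ≠ ε)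
    (hpos : 0 < ⟪δ, ε⟫) : δ - ε ∈ R.roots := by
  obtain ⟨n, hn⟩ := R.exists_int_inner hδ hε
  obtain ⟨m, hm⟩ := R.exists_int_inner hε hδ
  have hδδ := R.inner_self_pos hδ
  have hεε := R.inner_self_pos hε
  have hcs := real_inner_mul_inner_self_le δ ε
  rw [real_inner_comm δ ε] at hm
  have hn0 : 0 < n := by
    have : (0 : ℝ) < n := by
      by_contra! h
      nlinarith [mul_nonpos_of_nonpos_of_nonneg h hεε.le]
    exact_mod_cast this
  have hm0 : 0 < m := by
    have : (0 : ℝ) < m := by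
      by_contra! h
      nlinarith [mul_nonpos_of_nonpos_of_nonneg h hδδ.le]
    exact_mod_cast this
  have hnm : n * m ≤ 4 := by
    have h4 : (n * m : ℝ) * (⟪δ, δ⟫ * ⟪ε, ε⟫) ≤ 4 * (⟪δ, δ⟫ * ⟪ε, ε⟫) := by
      calc (n * m : ℝ) * (⟪δ, δ⟫ * ⟪ε, ε⟫) = (n * ⟪ε, ε⟫) * (m * ⟪δ, δ⟫) := by ring
        _ = 4 * (⟪δ, ε⟫ * ⟪δ, ε⟫) := by rw [← hn, ← hm]; ring
        _ ≤ _ := by linarith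
    exact_mod_cast le_of_mul_le_mul_right h4 (mul_pos hδδ hεε)
  by_cases hn1 : n = 1
  · subst hn1
    simpa using R.sub_smul_mem hδ hε hn
  by_cases hm1 : m = 1
  · subst hm1
    have := R.neg_mem _ (R.sub_smul_mem hε hδ (by rw [real_inner_comm δ ε]; exact hm))
    simpa using this
  have hn2 : n = 2 := by nlinarith [show 2 ≤ n by omega, show 2 ≤ m by omega]
  have hm2 : m = 2 := by nlinarith [show 2 ≤ n by omega, show 2 ≤ m by omega]
  subst hn2 hm2
  push_cast at hn hm
  have h0 : ⟪δ - ε, δ - ε⟫ = 0 := by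
    rw [real_inner_sub_sub_self]
    linarith
  exact absurd (sub_eq_zero.mp (inner_self_eq_zero.mp h0)) hne

lemma add_mem_roots {δ ε : V} (hδ : δ ∈ R.roots) (hε : ε ∈ R.roots) (hne : δ ≠ -ε)
    (hneg : ⟪δ, ε⟫ < 0) : δ + ε ∈ R.roots := by
  have := R.sub_mem_roots hδ (R.neg_mem ε hε) hne (by rw [inner_neg_right]; linarith)
  rwa [sub_neg_eq_add] at this

/-- A simple reflection preserves the positive roots other than the simple root itself. -/
lemma sub_smul_simple_mem_pos {δ α : V} (hδ : δ ∈ R.pos) (hα : α ∈ R.simple) (hne : δ ≠ α)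
    {k : ℝ} (hk : 2 * ⟪δ, α⟫ = k * ⟪α, α⟫) : δ - k • α ∈ R.pos := by
  have hroot := R.sub_smul_mem (R.pos_subset hδ) (R.simple_mem_roots hα) hk
  obtain ⟨β, hβ, hβα, hc⟩ : ∃ β ∈ R.simple, β ≠ α ∧ 0 < R.coeff δ β := by
    by_contra! H
    have hδα : δ = R.coeff δ α • α := by
      conv_lhs => rw [R.coeff_spec δ]
      refine Finset.sum_eq_single α (fun β hβ hβα => ?_) (fun h => absurd hα h)
      rw [le_antisymm (H β hβ hβα) (R.pos_coeff_nonneg δ hδ β hβ), zero_smul]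
    rcases R.reduced α (R.simple_mem_roots hα) (R.coeff δ α)
      (hδα ▸ R.pos_subset hδ) with h | h
    · exact hne (by rw [hδα, h, one_smul])
    · refine R.pos_neg_not α (R.simple_subset hα) ?_
      rw [h, neg_one_smul] at hδα
      exact hδα ▸ hδ
  refine R.mem_pos_of_coeff_pos hroot hβ ?_
  rw [R.coeff_sub_smul_simple δ k hα hβ, if_neg hβα, sub_zero]
  exact hc

/-- Induction on positive roots: every positive root is obtained from a simple root by
successive simple reflections staying among the positive roots. -/
lemma pos_induction {P : V → Prop} (simple : ∀ α ∈ R.simple, P α)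
    (reflect : ∀ α ∈ R.simple, ∀ δ ∈ R.pos, ∀ k : ℤ, 2 * ⟪δ, α⟫ = k * ⟪α, α⟫ →
      P (δ - (k : ℝ) • α) → P δ) {δ : V} (hδ : δ ∈ R.pos) : P δ := by
  have main : ∀ n : ℕ, ∀ δ ∈ R.pos, R.height δ ≤ n → P δ := by
    intro n
    induction n with
    | zero =>
      intro δ hδ hn
      exfalso
      have hnn := R.pos_coeff_nonneg δ hδ
      have h0 : R.height δ = 0 :=
        le_antisymm (by simpa using hn) (Finset.sum_nonneg hnn)
      exact R.root_ne_zero δ (R.pos_subset hδ)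
        (R.eq_zero_of_coeff_eq_zero ((Finset.sum_eq_zero_iff_of_nonneg hnn).mp h0))
    | succ n ih =>
      intro δ hδ hn
      by_cases hs : δ ∈ R.simple
      · exact simple δ hs
      obtain ⟨α, hα, -, hpos⟩ := R.exists_simple_inner_pos
        (R.root_ne_zero δ (R.pos_subset hδ)) (R.pos_coeff_nonneg δ hδ)
      obtain ⟨k, hk⟩ := R.exists_int_inner (R.pos_subset hδ) (R.simple_mem_roots hα)
      have hαα := R.inner_self_pos (R.simple_mem_roots hα)
      have hk0 : (0 : ℝ) < k := by
        by_contra! h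
        nlinarith [mul_nonpos_of_nonpos_of_nonneg h hαα.le]
      have hk1 : (1 : ℝ) ≤ k := by exact_mod_cast (show 0 < k by exact_mod_cast hk0)
      refine reflect α hα δ hδ k hk (ih _ ?_ ?_)
      · exact R.sub_smul_simple_mem_pos hδ hα (fun h => hs (h ▸ hα)) hk
      · rw [R.height_sub_smul_simple δ k hα]
        push_cast at hn
        linarith
  obtain ⟨n, hn⟩ := exists_nat_ge (R.height δ)
  exact main n δ hδ hn

lemma exists_int_coeff {δ : V} (hδ : δ ∈ R.pos) :
    ∀ β ∈ R.simple, ∃ n : ℤ, R.coeff δ β = n := by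
  refine R.pos_induction (P := fun δ => ∀ β ∈ R.simple, ∃ n : ℤ, R.coeff δ β = n) ?_ ?_ hδ
  · intro α hα β hβ
    have := R.coeff_smul_simple 1 hα hβ
    rw [one_smul] at this
    exact ⟨if β = α then 1 else 0, by rw [this]; split_ifs <;> simp⟩
  · intro α hα δ _ k _ ih β hβ
    obtain ⟨n, hn⟩ := ih β hβ
    rw [R.coeff_sub_smul_simple δ k hα hβ] at hn
    refine ⟨n + if β = α then k else 0, ?_⟩
    rw [sub_eq_iff_eq_add] at hn
    rw [hn]
    split_ifs <;> simp

end Roots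

section HalfSum

lemma two_mul_inner_gamma_simple {α : V} (hα : α ∈ R.simple) :
    2 * ⟪R.gamma, α⟫ = ⟪α, α⟫ := by
  have hαα := R.inner_self_pos (R.simple_mem_roots hα)
  have hrefl (δ : V) : 2 * ⟪δ, α⟫ = (2 * ⟪δ, α⟫ / ⟪α, α⟫) * ⟪α, α⟫ :=
    (div_mul_cancel₀ _ hαα.ne').symm
  have hneg (δ : V) : ⟪δ - (2 * ⟪δ, α⟫ / ⟪α, α⟫) • α, α⟫ = -⟪δ, α⟫ := by
    rw [inner_sub_left, real_inner_smul_left, ← hrefl]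
    ring
  have hsum : ∑ δ ∈ R.pos.erase α, ⟪δ, α⟫ = 0 := by
    refine Finset.sum_involution (fun δ _ => δ - (2 * ⟪δ, α⟫ / ⟪α, α⟫) • α) ?_ ?_ ?_ ?_
    · intro δ _
      rw [hneg]
      ring
    · intro δ _ h0 heq
      have := hneg δ
      rw [heq] at this
      exact h0 (by linarith)
    · intro δ hδ
      obtain ⟨hne, hδ⟩ := Finset.mem_erase.mp hδ
      refine Finset.mem_erase.mpr
        ⟨fun h => ?_, R.sub_smul_simple_mem_pos hδ hα hne (hrefl δ)⟩
      have hmem := R.neg_mem _ (R.pos_subset hδ)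
      have hδα : δ = (1 + 2 * ⟪δ, α⟫ / ⟪α, α⟫) • α := by
        rw [add_smul, one_smul]
        exact sub_eq_iff_eq_add.mp h
      rcases R.reduced α (R.simple_mem_roots hα) _ (hδα ▸ R.pos_subset hδ) with h1 | h1
      · exact hne (by rw [hδα, h1, one_smul])
      · rw [h1, neg_one_smul] at hδα
        exact R.pos_neg_not α (R.simple_subset hα) (hδα ▸ hδ)
    · intro δ _
      simp only [hneg]
      rw [mul_neg, neg_div, neg_smul, sub_neg_eq_add, sub_add_cancel]
  rw [gamma, real_inner_smul_left, sum_inner,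
    ← Finset.add_sum_erase _ _ (R.simple_subset hα), hsum]
  ring

lemma exists_int_inner_gamma {δ : V} (hδ : δ ∈ R.pos) :
    ∃ n : ℤ, 2 * ⟪R.gamma, δ⟫ = n * ⟪δ, δ⟫ := by
  refine R.pos_induction (P := fun δ => ∃ n : ℤ, 2 * ⟪R.gamma, δ⟫ = n * ⟪δ, δ⟫) ?_ ?_ hδ
  · intro α hα
    exact ⟨1, by rw [R.two_mul_inner_gamma_simple hα]; simp⟩
  · rintro α hα δ hδ k hk ⟨n, hn⟩
    obtain ⟨m, hm⟩ := R.exists_int_inner (R.simple_mem_roots hα) (R.pos_subset hδ)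
    have hγ := R.two_mul_inner_gamma_simple hα
    have hself : ⟪δ - (k : ℝ) • α, δ - (k : ℝ) • α⟫ = ⟪δ, δ⟫ := by
      rw [real_inner_sub_sub_self, real_inner_smul_right, real_inner_smul_right,
        real_inner_smul_left]
      linear_combination (-k : ℝ) * hk
    rw [hself, inner_sub_right, real_inner_smul_right] at hn
    rw [real_inner_comm δ α] at hm
    refine ⟨n + m, ?_⟩
    push_cast
    linear_combination hn + k * hγ + hm - hk

end HalfSum

/-- Adding a simple root `α` no longer than the root `σ` preserves negativity of a regular
weight `μ` with `2(μ,α) ≤ (α,α)`, and the sum is again at least as long as `α`. -/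
lemma inner_add_lt_zero {μ σ α : V} (hreg : R.IsRegular μ)
    (hint : ∀ ε ∈ R.pos, ∃ n : ℤ, 2 * ⟪μ, ε⟫ = n * ⟪ε, ε⟫)
    (hσ : σ ∈ R.pos) (hα : α ∈ R.roots) (hsum : σ + α ∈ R.pos)
    (hμα : 2 * ⟪μ, α⟫ ≤ ⟪α, α⟫) (hμσ : ⟪μ, σ⟫ < 0) (hle : ‖α‖ ≤ ‖σ‖) :
    ⟪μ, σ + α⟫ < 0 ∧ ‖α‖ ≤ ‖σ + α‖ := by
  have hσσ := R.inner_self_pos (R.pos_subset hσ)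
  have hlen : ⟪α, α⟫ ≤ ⟪σ, σ⟫ := by
    rw [real_inner_self_eq_norm_sq, real_inner_self_eq_norm_sq]
    gcongr
  constructor
  · obtain ⟨n, hn⟩ := hint σ hσ
    refine lt_of_le_of_ne ?_ (hreg _ hsum)
    have hn0 : (n : ℝ) < 0 := by
      by_contra! h
      nlinarith [mul_nonneg h hσσ.le]
    have hn1 : (n : ℝ) ≤ -1 := by
      have : n < 0 := by exact_mod_cast hn0
      exact_mod_cast (show n ≤ -1 by omega)
    rw [inner_add_right]
    nlinarith
  · obtain ⟨m, hm⟩ := R.exists_int_inner hα (R.pos_subset hσ)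
    rw [real_inner_comm σ α] at hm
    have hadd := R.inner_self_pos (R.pos_subset hsum)
    rw [real_inner_add_add_self] at hadd
    have hm1 : (-1 : ℝ) ≤ m := by
      by_contra! h
      have : m ≤ -2 := by
        have : m < -1 := by exact_mod_cast h
        omega
      have : (m : ℝ) ≤ -2 := by exact_mod_cast this
      nlinarith
    refine le_of_sq_le_sq ?_ (norm_nonneg _)
    rw [← real_inner_self_eq_norm_sq, ← real_inner_self_eq_norm_sq, real_inner_add_add_self]
    nlinarith

/-- Negativity of a regular weight `μ` propagates from a positive root `σ` to a positive root
`δ ≥ σ` when the simple roots occurring in `δ - σ` have common length `L ≤ ‖σ‖` and satisfy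
`2(μ,α) ≤ (α,α)`. -/
lemma inner_lt_zero_of_cle {μ : V} (hreg : R.IsRegular μ)
    (hint : ∀ ε ∈ R.pos, ∃ n : ℤ, 2 * ⟪μ, ε⟫ = n * ⟪ε, ε⟫) {L : ℝ} (n : ℕ) :
    ∀ σ ∈ R.pos, ∀ δ ∈ R.pos, R.cle σ δ → R.height (δ - σ) ≤ n →
      (∀ α ∈ R.simple, R.coeff σ α < R.coeff δ α → ‖α‖ = L ∧ 2 * ⟪μ, α⟫ ≤ ⟪α, α⟫) →
      ⟪μ, σ⟫ < 0 → L ≤ ‖σ‖ → ⟪μ, δ⟫ < 0 ∧ L ≤ ‖δ‖ := by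
  induction n with
  | zero =>
    intro σ _ δ _ hle hn _ hμ hL
    have hnn : ∀ α ∈ R.simple, 0 ≤ R.coeff (δ - σ) α := fun α hα => by
      rw [R.coeff_sub _ _ hα]
      exact sub_nonneg.mpr (hle α hα)
    have h0 : R.height (δ - σ) = 0 :=
      le_antisymm (by simpa using hn) (Finset.sum_nonneg hnn)
    have : δ = σ := sub_eq_zero.mp
      (R.eq_zero_of_coeff_eq_zero ((Finset.sum_eq_zero_iff_of_nonneg hnn).mp h0))
    exact this ▸ ⟨hμ, hL⟩
  | succ n ih =>
    intro σ hσ δ hδ hle hn hα' hμ hL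
    by_cases heq : δ = σ
    · exact heq ▸ ⟨hμ, hL⟩
    obtain ⟨α, hα, hcα, hpos⟩ := R.exists_simple_inner_pos (sub_ne_zero.mpr heq)
      (fun α hα => by rw [R.coeff_sub _ _ hα]; exact sub_nonneg.mpr (hle α hα))
    rw [R.coeff_sub _ _ hα, sub_pos] at hcα
    obtain ⟨hαL, hμα⟩ := hα' α hα hcα
    have hgap : R.coeff σ α + 1 ≤ R.coeff δ α := by
      obtain ⟨a, ha⟩ := R.exists_int_coeff hσ α hα
      obtain ⟨b, hb⟩ := R.exists_int_coeff hδ α hα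
      rw [ha, hb] at hcα ⊢
      exact_mod_cast (show a < b by exact_mod_cast hcα)
    have hsub : ∀ ξ : V, ∀ β ∈ R.simple,
        R.coeff (ξ - α) β = R.coeff ξ β - if β = α then 1 else 0 := fun ξ β hβ => by
      simpa using R.coeff_sub_smul_simple ξ 1 hα hβ
    have hadd : ∀ ξ : V, ∀ β ∈ R.simple,
        R.coeff (ξ + α) β = R.coeff ξ β + if β = α then 1 else 0 := fun ξ β hβ => by
      have := hsub (ξ + α) β hβ
      rw [add_sub_cancel_right] at this
      linarith
    have hheight : R.height (δ - σ - α) ≤ n := by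
      have := R.height_sub_smul_simple (δ - σ) 1 hα
      rw [one_smul] at this
      rw [this]
      push_cast at hn
      linarith
    have hαroot := R.simple_mem_roots hα
    have hσnn := R.pos_coeff_nonneg σ hσ
    rw [inner_sub_left, sub_pos] at hpos
    by_cases hσα : ⟪σ, α⟫ < 0
    · have hne : σ ≠ -α := fun h =>
        R.pos_neg_not α (R.simple_subset hα) (h ▸ hσ)
      have hmem : σ + α ∈ R.pos := by
        refine R.mem_pos_of_coeff_nonneg
          (R.add_mem_roots (R.pos_subset hσ) hαroot hne hσα) fun β hβ => ?_
        rw [hadd σ β hβ]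
        have := hσnn β hβ
        split_ifs <;> linarith
      obtain ⟨hμ', hL'⟩ := R.inner_add_lt_zero hreg hint hσ hαroot hmem hμα hμ (hαL ▸ hL)
      refine ih (σ + α) hmem δ hδ ?_ (by rwa [← sub_sub]) ?_ hμ' (hαL ▸ hL')
      · intro β hβ
        rw [hadd σ β hβ]
        split_ifs with h
        · exact h ▸ hgap
        · simpa using hle β hβ
      · intro β hβ hlt
        refine hα' β hβ (lt_of_le_of_lt ?_ hlt)
        rw [hadd σ β hβ]
        split_ifs <;> linarith
    · have hne : δ ≠ α := by
        rintro rfl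
        refine R.root_ne_zero σ (R.pos_subset hσ) (R.eq_zero_of_coeff_eq_zero fun β hβ => ?_)
        refine le_antisymm ?_ (hσnn β hβ)
        have h1 := R.coeff_smul_simple 1 hα hβ
        have h2 := hle β hβ
        rw [one_smul] at h1
        split_ifs at h1 with h
        · subst h
          linarith
        · linarith
      have hcle : R.cle σ (δ - α) := by
        intro β hβ
        rw [hsub δ β hβ]
        split_ifs with h
        · subst h
          linarith
        · simpa using hle β hβ
      have hmem : δ - α ∈ R.pos :=
        R.mem_pos_of_coeff_nonneg
          (R.sub_mem_roots (R.pos_subset hδ) hαroot hne (by linarith))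
          fun β hβ => (hσnn β hβ).trans (hcle β hβ)
      obtain ⟨hμ', hL'⟩ := ih σ hσ (δ - α) hmem hcle (by rwa [sub_right_comm]) (by
        intro β hβ hlt
        refine hα' β hβ (lt_of_lt_of_le hlt ?_)
        rw [hsub δ β hβ]
        split_ifs <;> linarith) hμ hL
      have := R.inner_add_lt_zero hreg hint hmem hαroot (by rwa [sub_add_cancel]) hμα hμ'
        (hαL ▸ hL')
      rw [sub_add_cancel] at this
      exact ⟨this.1, hαL ▸ this.2⟩

end RootSystemData

/-- If `Λ` is a weight with `(Λ,α) < 0` for `α ∈ A`, `(Λ,β) = 0` for `β ∈ B`, and `Λ + γ`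
is regular, then `(Λ + γ, δ) < 0` for every significant `(A,B)`-root `δ`. -/
theorem inner_lt_zero_of_significant
    {V : Type*} [NormedAddCommGroup V] [InnerProductSpace ℝ V]
    (R : RootSystemData V)
    (A B : Finset V) (hA : A ⊆ R.simple) (hB : B ⊆ R.simple) (hAB : Disjoint A B)
    (Λ : V) (hw : R.IsWeight Λ)
    (hAneg : ∀ α ∈ A, ⟪Λ, α⟫ < 0) (hB0 : ∀ β ∈ B, ⟪Λ, β⟫ = 0)
    (hreg : R.IsRegular (Λ + R.gamma)) :
    ∀ δ : V, R.IsSignificant A B δ → ⟪Λ + R.gamma, δ⟫ < 0 := by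
  rintro δ ⟨⟨hδ, hδsupp, -⟩, σ, ⟨hσ, hσsupp, -⟩, hle, hsum, hsame, hlen⟩
  have hint : ∀ ε ∈ R.pos, ∃ n : ℤ, 2 * ⟪Λ + R.gamma, ε⟫ = n * ⟪ε, ε⟫ := by
    intro ε hε
    obtain ⟨n, hn⟩ := hw ε (R.pos_subset hε)
    rw [div_eq_iff (R.inner_self_pos (R.pos_subset hε)).ne'] at hn
    obtain ⟨m, hm⟩ := R.exists_int_inner_gamma hε
    refine ⟨n + m, ?_⟩
    rw [inner_add_left]
    push_cast
    linear_combination hn + hm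
  have hμB : ∀ β ∈ B, 2 * ⟪Λ + R.gamma, β⟫ = ⟪β, β⟫ := fun β hβ => by
    rw [inner_add_left, hB0 β hβ, zero_add, R.two_mul_inner_gamma_simple (hB hβ)]
  have hμA : ∀ α ∈ A, 2 * ⟪Λ + R.gamma, α⟫ ≤ -⟪α, α⟫ := by
    intro α hα
    have hαpos := R.simple_subset (hA hα)
    have hαα := R.inner_self_pos (R.pos_subset hαpos)
    obtain ⟨n, hn⟩ := hint α hαpos
    have hneg := hAneg α hα
    have hγ := R.two_mul_inner_gamma_simple (hA hα)
    have hn1 : n < 1 := by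
      have : (n : ℝ) < 1 := by
        by_contra! h
        rw [inner_add_left] at hn
        nlinarith
      exact_mod_cast this
    have hn0 : n ≠ 0 := by
      rintro rfl
      exact hreg α hαpos (by simpa using hn)
    have : (n : ℝ) ≤ -1 := by exact_mod_cast (show n ≤ -1 by omega)
    rw [hn]
    nlinarith
  have hμ : ∀ α ∈ A ∪ B, 2 * ⟪Λ + R.gamma, α⟫ ≤ ⟪α, α⟫ := by
    intro α hα
    rcases Finset.mem_union.mp hα with h | h
    · have := hμA α h
      have := real_inner_self_nonneg (x := α)
      linarith
    · exact (hμB α h).le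
  have hμσ : ⟪Λ + R.gamma, σ⟫ < 0 := by
    refine lt_of_le_of_ne ?_ (hreg σ hσ)
    have hsplit : ⟪Λ + R.gamma, σ⟫ = ∑ α ∈ A, R.coeff σ α * ⟪Λ + R.gamma, α⟫ +
        ∑ β ∈ B, R.coeff σ β * ⟪Λ + R.gamma, β⟫ := by
      rw [R.inner_eq_sum_coeff, ← Finset.sum_union hAB]
      refine (Finset.sum_subset (Finset.union_subset hA hB) fun α hα hnot => ?_).symm
      have : R.coeff σ α = 0 := by
        by_contra h
        exact hnot (hσsupp (Finset.mem_filter.mpr ⟨hα, h⟩))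
      rw [this, zero_mul]
    have h1 : 2 * ∑ α ∈ A, R.coeff σ α * ⟪Λ + R.gamma, α⟫ ≤
        -∑ α ∈ A, R.coeff σ α * ⟪α, α⟫ := by
      rw [Finset.mul_sum, ← Finset.sum_neg_distrib]
      refine Finset.sum_le_sum fun α hα => ?_
      nlinarith [mul_le_mul_of_nonneg_left (hμA α hα) (R.pos_coeff_nonneg σ hσ α (hA hα))]
    have h2 : 2 * ∑ β ∈ B, R.coeff σ β * ⟪Λ + R.gamma, β⟫ =
        ∑ β ∈ B, R.coeff σ β * ⟪β, β⟫ := by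
      rw [Finset.mul_sum]
      refine Finset.sum_congr rfl fun β hβ => ?_
      rw [← hμB β hβ]
      ring
    linarith
  have hmem : ∀ α ∈ R.simple, R.coeff σ α < R.coeff δ α →
      α ∈ R.support (δ - σ) ∧ α ∈ A ∪ B := by
    intro α hα hlt
    refine ⟨Finset.mem_filter.mpr ⟨hα, ?_⟩, hδsupp (Finset.mem_filter.mpr ⟨hα, ?_⟩)⟩
    · rw [R.coeff_sub _ _ hα]
      exact (sub_pos.mpr hlt).ne'
    · exact ((R.pos_coeff_nonneg σ hσ α hα).trans_lt hlt).ne'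
  obtain ⟨L, hL, hLσ⟩ : ∃ L : ℝ, (∀ α ∈ R.support (δ - σ), ‖α‖ = L) ∧ L ≤ ‖σ‖ := by
    rcases (R.support (δ - σ)).eq_empty_or_nonempty with h | ⟨x, hx⟩
    · exact ⟨‖σ‖, by simp [h], le_rfl⟩
    · exact ⟨‖x‖, fun α hα => hsame α hα x hx, hlen x hx⟩
  obtain ⟨n, hn⟩ := exists_nat_ge (R.height (δ - σ))
  exact (R.inner_lt_zero_of_cle hreg hint n σ hσ δ hδ hle hn
    (fun α hα hlt => ⟨hL α (hmem α hα hlt).1, hμ α (hmem α hα hlt).2⟩) hμσ hLσ).1
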